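/- Let V be a finite-dimensional real inner product space and let f, E ∈ V. Define the bilinear form ḡ on V by ḡ(X,Y) = ⟨X,Y⟩ + ⟨f,X⟩⟨f,Y⟩. Then: (i) ḡ is positive definite; (ii) there exists a unique W ∈ V such that ḡ(W,X) = (⟨E,X⟩ + ⟨f,E⟩⟨f,X⟩)/√(1+‖f‖²) for all X ∈ V; and (iii) ḡ(W,W) = (‖E‖² + ⟨f,E⟩²)/(1+‖f‖²) ≤ ‖E‖². -/

import Mathlib

open scoped RealInnerProductSpace

/-- The Jang metric `ḡ(X,Y) = ⟨X,Y⟩ + ⟨f,X⟩⟨f,Y⟩` is positive definite; the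
induced electric 1-form `X ↦ (⟨E,X⟩ + ⟨f,E⟩⟨f,X⟩)/√(1+‖f‖²)` is represented by a
unique vector `W`, and `ḡ(W,W) = (‖E‖² + ⟨f,E⟩²)/(1+‖f‖²) ≤ ‖E‖²`. -/
theorem jang_electric_field_norm
    {V : Type*} [NormedAddCommGroup V] [InnerProductSpace ℝ V]
    [FiniteDimensional ℝ V] (f E : V)
    (gbar : V → V → ℝ)
    (hg : ∀ X Y : V, gbar X Y = ⟪X, Y⟫ + ⟪f, X⟫ * ⟪f, Y⟫) :
    (∀ X : V, X ≠ 0 → 0 < gbar X X) ∧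
    (∃! W : V, ∀ X : V,
        gbar W X = (⟪E, X⟫ + ⟪f, E⟫ * ⟪f, X⟫) / Real.sqrt (1 + ‖f‖ ^ 2)) ∧
    (∀ W : V,
      (∀ X : V, gbar W X = (⟪E, X⟫ + ⟪f, E⟫ * ⟪f, X⟫) / Real.sqrt (1 + ‖f‖ ^ 2)) →
        gbar W W = (‖E‖ ^ 2 + ⟪f, E⟫ ^ 2) / (1 + ‖f‖ ^ 2) ∧
        (‖E‖ ^ 2 + ⟪f, E⟫ ^ 2) / (1 + ‖f‖ ^ 2) ≤ ‖E‖ ^ 2) := by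
  have hpos : ∀ X : V, X ≠ 0 → 0 < gbar X X := by
    intro X hX
    rw [hg, real_inner_self_eq_norm_sq]
    have h1 : 0 < ‖X‖ := norm_pos_iff.mpr hX
    have h2 : 0 ≤ ⟪f, X⟫ * ⟪f, X⟫ := mul_self_nonneg _
    positivity
  have hs : 0 < 1 + ‖f‖ ^ 2 := by positivity
  set s := Real.sqrt (1 + ‖f‖ ^ 2) with hsdef
  have hss : s ^ 2 = 1 + ‖f‖ ^ 2 := Real.sq_sqrt hs.le
  have hs0 : 0 < s := Real.sqrt_pos.mpr hs
  have hex : ∀ X : V, gbar (s⁻¹ • E) X = (⟪E, X⟫ + ⟪f, E⟫ * ⟪f, X⟫) / s := by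
    intro X
    rw [hg, real_inner_smul_left, real_inner_smul_right]
    ring
  have huniq : ∀ W : V, (∀ X : V, gbar W X = (⟪E, X⟫ + ⟪f, E⟫ * ⟪f, X⟫) / s) →
      W = s⁻¹ • E := by
    intro W hW
    by_contra hne
    have h1 := hpos (W - s⁻¹ • E) (sub_ne_zero.mpr hne)
    have h2 := (hW (W - s⁻¹ • E)).trans (hex (W - s⁻¹ • E)).symm
    rw [hg, hg] at h2
    rw [hg, inner_sub_left] at h1
    have h3 : ⟪f, W - s⁻¹ • E⟫ = ⟪f, W⟫ - ⟪f, s⁻¹ • E⟫ := inner_sub_right _ _ _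
    have h4 : ⟪f, W - s⁻¹ • E⟫ * ⟪f, W - s⁻¹ • E⟫
        = ⟪f, W⟫ * ⟪f, W - s⁻¹ • E⟫ - ⟪f, s⁻¹ • E⟫ * ⟪f, W - s⁻¹ • E⟫ := by
      rw [← sub_mul, ← h3]
    linarith
  refine ⟨hpos, ⟨s⁻¹ • E, hex, huniq⟩, ?_⟩
  intro W hW
  constructor
  · rw [huniq W hW, hex, real_inner_smul_right, real_inner_smul_right,
      real_inner_self_eq_norm_sq, ← hss]
    field_simp
  · rw [div_le_iff₀ hs]
    have h := abs_real_inner_le_norm f E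
    have h2 : ⟪f, E⟫ ^ 2 ≤ (‖f‖ * ‖E‖) ^ 2 := sq_le_sq' (abs_le.mp h).1 (abs_le.mp h).2
    nlinarith
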